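/- Let (W, S) be a Coxeter system and a ∈ S. The restriction maps give a bijection between maximal partial special matchings φ of W with φ(e) = a and families (α_s)_{s ∈ S\{a}} where each α_s is a special matching of the dihedral group P_s = ⟨s, a⟩ with α_s(e) = a: every maximal matching restricts to such a family, and every such family extends uniquely to a maximal partial special matching of W. -/

import Mathlib

open CoxeterSystem Polynomial

section CoxPre

variable {B : Type*} {W : Type*} [Group W] {M : CoxeterMatrix B}

/-- The alternating word of length `n` starting with the letter `i`
(and then alternating between `i` and `j`). -/
def altW (i j : B) : ℕ → List B
  | 0 => []
  | n + 1 => i :: altW j i n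

variable (cs : CoxeterSystem M W)

/-- The Bruhat order on a Coxeter group: the reflexive-transitive closure of the
relation `u → u * t` (`t` a reflection) when the length goes up. -/
def bruhatLE : W → W → Prop :=
  Relation.ReflTransGen
    (fun u v => ∃ t, cs.IsReflection t ∧ v = u * t ∧ cs.length u < cs.length v)

/-- The covering relation of the Bruhat order. -/
def bCov (u v : W) : Prop :=
  bruhatLE cs u v ∧ u ≠ v ∧ ∀ z, bruhatLE cs u z → bruhatLE cs z v → z = u ∨ z = v

/-- The set of coatoms of `v` in the Bruhat order. -/
def bCoat (v : W) : Set W := {x | bCov cs x v}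

/-- A partial special matching of `W` equipped with the Bruhat order: a Bruhat order
ideal `dom` together with an involution of it such that `u ⋖ φ u` or `φ u ⋖ u` for all
`u ∈ dom`, satisfying the coatom condition. -/
structure BSM where
  dom : Set W
  toFun : W → W
  ideal : ∀ ⦃x y : W⦄, y ∈ dom → bruhatLE cs x y → x ∈ dom
  maps : ∀ x ∈ dom, toFun x ∈ dom
  invol : ∀ x ∈ dom, toFun (toFun x) = x
  cov : ∀ x ∈ dom, bCov cs (toFun x) x ∨ bCov cs x (toFun x)
  coatom : ∀ u ∈ dom, bCov cs u (toFun u) →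
    bCoat cs (toFun u) =
      {u} ∪ {w | ∃ v, bCov cs v u ∧ bCov cs v (toFun v) ∧ w = toFun v}

/-- The standard dihedral subgroup `⟨s,t⟩` of `W`, as a set. -/
def dihedral (s t : B) : Set W :=
  (Subgroup.closure {cs.simple s, cs.simple t} : Subgroup W)

/-- `w` is full with respect to `J ⊆ S`: for all distinct `i, j ∈ J`, `m i j < ∞` and the
longest element of `⟨i,j⟩` is `≤ w` in Bruhat order. -/
def IsFullWrt (J : Set B) (w : W) : Prop :=
  ∀ i ∈ J, ∀ j ∈ J, i ≠ j →
    M i j ≠ 0 ∧ bruhatLE cs (cs.wordProd (altW i j (M i j))) w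

/-- The standard axioms characterizing the `R`-polynomials of the Hecke algebra of `W`. -/
def RAxioms (R : W → W → Polynomial ℤ) : Prop :=
  (∀ u, R u u = 1) ∧
  (∀ u v, ¬ bruhatLE cs u v → R u v = 0) ∧
  (∀ (i : B) (x y : W),
      cs.length (cs.simple i * x) = cs.length x + 1 →
      cs.length (cs.simple i * y) = cs.length y + 1 →
      R (cs.simple i * x) (cs.simple i * y) = R x y ∧
      R x (cs.simple i * y) = (X - 1) * R x y + X * R (cs.simple i * x) y) ∧
  (∀ (i : B) (x y : W),
      cs.length (x * cs.simple i) = cs.length x + 1 →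
      cs.length (y * cs.simple i) = cs.length y + 1 →
      R (x * cs.simple i) (y * cs.simple i) = R x y ∧
      R x (y * cs.simple i) = (X - 1) * R x y + X * R (x * cs.simple i) y)

variable {cs}

/-- `ψ` extends the partial special matching `φ`. -/
def BExtends (ψ φ : BSM cs) : Prop :=
  φ.dom ⊆ ψ.dom ∧ ∀ x ∈ φ.dom, ψ.toFun x = φ.toFun x

/-- `φ` is a maximal partial special matching. -/
def BMax (φ : BSM cs) : Prop := ∀ ψ : BSM cs, BExtends ψ φ → ψ.dom = φ.dom

/-- `φ` is `g`-regular on the left: its domain is stable under left multiplication by `g`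
and `φ` commutes with left multiplication by `g`. -/
def LeftReg (φ : BSM cs) (g : W) : Prop :=
  (∀ x ∈ φ.dom, g * x ∈ φ.dom) ∧ ∀ x ∈ φ.dom, φ.toFun (g * x) = g * φ.toFun x

/-- `φ` is `g`-regular on the right. -/
def RightReg (φ : BSM cs) (g : W) : Prop :=
  (∀ x ∈ φ.dom, x * g ∈ φ.dom) ∧ ∀ x ∈ φ.dom, φ.toFun (x * g) = φ.toFun x * g

end CoxPre

namespace CoxeterSystem

section Exchange

variable {B : Type*} {W : Type*} [Group W] {M : CoxeterMatrix B} (cs : CoxeterSystem M W)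

open Classical in
/-- The action of a simple reflection on pairs (group element, sign) used to count how often an
element occurs in an inversion sequence, modulo two. -/
noncomputable def signedConj (i : B) : Equiv.Perm (W × ZMod 2) :=
  Function.Involutive.toPerm
    (fun p => (cs.simple i * p.1 * cs.simple i, p.2 + if p.1 = cs.simple i then 1 else 0)) (by
      rintro ⟨t, e⟩
      have h : cs.simple i * t * cs.simple i = cs.simple i ↔ t = cs.simple i := by
        constructor
        · intro h
          have := congrArg (fun x => cs.simple i * x * cs.simple i) h
          simpa [mul_assoc] using this
        · rintro rfl; simp
      refine Prod.ext ?_ ?_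
      · simp [mul_assoc]
      · simp only [if_congr h rfl rfl, add_assoc, CharTwo.add_self_eq_zero, add_zero])

open Classical in
theorem signedConj_apply (i : B) (t : W) (e : ZMod 2) :
    cs.signedConj i (t, e) =
      (cs.simple i * t * cs.simple i, e + if t = cs.simple i then 1 else 0) := rfl

open Classical in
theorem signedConj_mul_pow_apply (i j : B) (k : ℕ) (t : W) (e : ZMod 2) :
    ((cs.signedConj i * cs.signedConj j) ^ k) (t, e) =
      (((cs.simple j * cs.simple i) ^ k)⁻¹ * t * (cs.simple j * cs.simple i) ^ k,
        e + ∑ l ∈ Finset.range (2 * k),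
          if t = (cs.simple j * cs.simple i) ^ l * cs.simple j then 1 else 0) := by
  induction k with
  | zero => simp
  | succ k ih =>
    set p := cs.simple j * cs.simple i with hp
    have hsc : SemiconjBy (cs.simple j) p p⁻¹ := by simp [SemiconjBy, hp, mul_assoc]
    have hk : cs.simple j * (p ^ k)⁻¹ = p ^ k * cs.simple j := by
      have := ((hsc.pow_right k).inv_right).eq
      rwa [inv_pow, inv_inv] at this
    rw [pow_succ', Equiv.Perm.mul_apply, ih, Equiv.Perm.mul_apply, signedConj_apply,
      signedConj_apply, show 2 * (k + 1) = 2 * k + 1 + 1 by ring, Finset.sum_range_succ,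
      Finset.sum_range_succ]
    have e1 : (p ^ k)⁻¹ * t * p ^ k = cs.simple j ↔ t = p ^ (2 * k) * cs.simple j := by
      rw [two_mul, pow_add, mul_assoc (p ^ k) (p ^ k), ← hk, mul_assoc, inv_mul_eq_iff_eq_mul,
        ← mul_assoc, eq_mul_inv_iff_mul_eq]
    have e2 : cs.simple j * ((p ^ k)⁻¹ * t * p ^ k) * cs.simple j = cs.simple i ↔
        t = p ^ (2 * k + 1) * cs.simple j := by
      have h1 : cs.simple j * ((p ^ k)⁻¹ * t * p ^ k) * cs.simple j = cs.simple i ↔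
          (p ^ k)⁻¹ * t * p ^ k = p * cs.simple j := by
        constructor
        · intro h
          have := congrArg (fun x => cs.simple j * x * cs.simple j) h
          simpa [mul_assoc, hp] using this
        · intro h
          rw [h, hp]; simp [mul_assoc]
      rw [h1, show p ^ (2 * k + 1) = p ^ k * p * p ^ k by
        rw [← pow_succ, ← pow_add]; congr 1; ring, mul_assoc (p ^ k * p) (p ^ k), ← hk, mul_assoc,
        inv_mul_eq_iff_eq_mul, mul_assoc (p ^ k) p, ← mul_assoc p,
        ← mul_assoc (p ^ k) (p * cs.simple j), eq_mul_inv_iff_mul_eq]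
    rw [if_congr e1 rfl rfl, if_congr e2 rfl rfl]
    refine Prod.ext ?_ ?_
    · simp [pow_succ, mul_assoc, hp]
    · simp [add_assoc]

theorem isLiftable_signedConj : M.IsLiftable cs.signedConj := by
  classical
  intro i j
  refine Equiv.ext ?_
  rintro ⟨t, e⟩
  have h : (cs.simple j * cs.simple i) ^ M i j = 1 := by
    rw [M.symmetric]; exact cs.simple_mul_simple_pow j i
  rw [signedConj_mul_pow_apply, h, two_mul, Finset.sum_range_add]
  simp only [pow_add, h, one_mul, CharTwo.add_self_eq_zero]
  simp

/-- The action of the Coxeter group on pairs (group element, sign). -/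
noncomputable def signedConjHom : W →* Equiv.Perm (W × ZMod 2) :=
  cs.lift ⟨cs.signedConj, cs.isLiftable_signedConj⟩

theorem signedConjHom_simple (i : B) : cs.signedConjHom (cs.simple i) = cs.signedConj i :=
  cs.lift_apply_simple _ i

theorem signedConjHom_apply_fst (w t : W) (e : ZMod 2) :
    (cs.signedConjHom w (t, e)).1 = w * t * w⁻¹ := by
  induction w using cs.simple_induction_left generalizing t e with
  | one => simp
  | mul_simple_left w i ih =>
    rw [map_mul, Equiv.Perm.mul_apply, signedConjHom_simple]
    rw [← Prod.mk.eta (p := cs.signedConjHom w (t, e)), signedConj_apply, ih]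
    simp [mul_assoc]

open Classical in
theorem signedConjHom_wordProd_apply (ω : List B) (t : W) (e : ZMod 2) :
    cs.signedConjHom (cs.wordProd ω) (t, e) =
      (cs.wordProd ω * t * (cs.wordProd ω)⁻¹, e + ((cs.rightInvSeq ω).count t : ZMod 2)) := by
  induction ω with
  | nil => simp
  | cons i ω ih =>
    have h : cs.wordProd ω * t * (cs.wordProd ω)⁻¹ = cs.simple i ↔
        (cs.wordProd ω)⁻¹ * cs.simple i * cs.wordProd ω = t := by
      rw [mul_inv_eq_iff_eq_mul]
      constructor
      · intro h
        rw [mul_assoc, ← h]; simp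
      · rintro rfl
        simp [mul_assoc]
    rw [wordProd_cons, map_mul, Equiv.Perm.mul_apply, ih, signedConjHom_simple, signedConj_apply,
      rightInvSeq, List.count_cons, if_congr h rfl rfl]
    refine Prod.ext ?_ ?_
    · simp [mul_assoc]
    · simp [add_assoc]

theorem signedConjHom_apply_snd (w t : W) (e : ZMod 2) :
    (cs.signedConjHom w (t, e)).2 = e + (cs.signedConjHom w (t, 0)).2 := by
  classical
  obtain ⟨ω, rfl⟩ := cs.wordProd_surjective w
  simp [signedConjHom_wordProd_apply]

theorem signedConjHom_reflection_self {t : W} (ht : cs.IsReflection t) :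
    (cs.signedConjHom t (t, 0)).2 = 1 := by
  classical
  obtain ⟨w, i, rfl⟩ := ht
  have h1 : cs.signedConjHom w⁻¹ (w * cs.simple i * w⁻¹, 0) =
      (cs.simple i, (cs.signedConjHom w⁻¹ (w * cs.simple i * w⁻¹, 0)).2) := by
    refine Prod.ext ?_ rfl
    rw [signedConjHom_apply_fst]; simp [mul_assoc]
  set c := (cs.signedConjHom w⁻¹ (w * cs.simple i * w⁻¹, 0)).2
  have h2 : cs.signedConjHom w (cs.simple i, c) = (w * cs.simple i * w⁻¹, 0) := by
    rw [← h1, ← Equiv.Perm.mul_apply, ← map_mul]; simp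
  have h3 := cs.signedConjHom_apply_snd w (cs.simple i) (c + 1)
  have h4 := cs.signedConjHom_apply_snd w (cs.simple i) c
  rw [h2] at h4
  rw [map_mul, map_mul, Equiv.Perm.mul_apply, h1, Equiv.Perm.mul_apply, signedConjHom_simple,
    signedConj_apply]
  simp only [simple_mul_simple_self, one_mul, if_true]
  rw [h3, add_right_comm, ← h4]
  simp

/-- The strong exchange property. -/
theorem strongExchange {ω : List B} {t : W} (ht : cs.IsReflection t)
    (hlt : cs.length (cs.wordProd ω * t) < cs.length (cs.wordProd ω)) :
    ∃ j < ω.length, cs.wordProd ω * t = cs.wordProd (ω.eraseIdx j) := by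
  classical
  have hmem : t ∈ cs.rightInvSeq ω := by
    by_contra hn
    have h0 : (cs.signedConjHom (cs.wordProd ω) (t, 0)).2 = 0 := by
      simp [signedConjHom_wordProd_apply, List.count_eq_zero_of_not_mem hn]
    have h1 : (cs.signedConjHom (cs.wordProd ω * t) (t, 0)).2 = 1 := by
      rw [map_mul, Equiv.Perm.mul_apply,
        ← Prod.mk.eta (p := cs.signedConjHom t (t, 0)), signedConjHom_apply_fst,
        signedConjHom_reflection_self cs ht, signedConjHom_apply_snd]
      simp [h0]
    obtain ⟨ω', hω', heq⟩ := cs.exists_isReduced (cs.wordProd ω * t)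
    have hmem : t ∈ cs.rightInvSeq ω' := by
      by_contra hn'
      rw [heq, signedConjHom_wordProd_apply, List.count_eq_zero_of_not_mem hn'] at h1
      simp at h1
    have := (cs.isRightInversion_of_mem_rightInvSeq hω' hmem).2
    rw [← heq, mul_assoc, ht.mul_self, mul_one] at this
    omega
  obtain ⟨j, hj, rfl⟩ := List.getElem_of_mem hmem
  refine ⟨j, by simpa using hj, ?_⟩
  rw [← cs.wordProd_mul_getD_rightInvSeq, List.getD_eq_getElem _ _ hj]

end Exchange

section Injective

variable {B : Type*} {W : Type*} [Group W] {M : CoxeterMatrix B} (cs : CoxeterSystem M W)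

/-- The vector of `B → ℝ` defining the reflection attached to `i` in (the dual of) the geometric
representation. -/
noncomputable def rootVec (M : CoxeterMatrix B) (i : B) : B → ℝ :=
  fun j => -2 * Real.cos (Real.pi / M i j)

theorem proj_rootVec_self (M : CoxeterMatrix B) (i : B) :
    (LinearMap.proj i : (B → ℝ) →ₗ[ℝ] ℝ) (rootVec M i) = 2 := by
  simp [rootVec]

open Polynomial.Chebyshev in
theorem isLiftable_reflection (M : CoxeterMatrix B) :
    M.IsLiftable (fun i => Module.reflection (proj_rootVec_self M i)) := by
  intro i j
  by_cases hij : i = j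
  · subst hij
    rw [M.diagonal, pow_one]
    refine LinearEquiv.ext fun z => ?_
    exact Module.involutive_reflection (proj_rootVec_self M i) z
  rcases Nat.eq_zero_or_pos (M i j) with h0 | hpos
  · rw [h0, pow_zero]
  have h1 : M i j ≠ 1 := M.off_diagonal i j hij
  refine LinearEquiv.ext fun z => ?_
  have ht : 2 * Real.cos (2 * Real.pi / M i j) =
      (LinearMap.proj i : (B → ℝ) →ₗ[ℝ] ℝ) (rootVec M j) *
      (LinearMap.proj j : (B → ℝ) →ₗ[ℝ] ℝ) (rootVec M i) - 2 := by
    simp only [rootVec, LinearMap.proj_apply]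
    rw [M.symmetric j i, mul_div_assoc, Real.cos_two_mul]
    ring
  rw [Module.reflection_mul_reflection_pow_apply _ _ _ _ _ ht]
  by_cases h2 : M i j = 2
  · have h2' : M j i = 2 := by rw [M.symmetric, h2]
    simp [h2, h2', rootVec]
    module
  set θ : ℝ := 2 * Real.pi / M i j with hθ
  have hm : (3 : ℝ) ≤ M i j := by exact_mod_cast (show 3 ≤ M i j by omega)
  have hsin : Real.sin θ ≠ 0 := by
    refine (Real.sin_pos_of_pos_of_lt_pi (by positivity) ?_).ne'
    rw [hθ, div_lt_iff₀ (by linarith)]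
    nlinarith [Real.pi_pos]
  have key : ∀ n : ℤ, (S ℝ n).eval (2 * Real.cos θ) = Real.sin ((n + 1) * θ) / Real.sin θ :=
    fun n => by rw [eq_div_iff hsin, S_two_mul_real_cos]
  rcases Nat.even_or_odd' (M i j) with ⟨k, hk | hk⟩
  · have e1 : ((M i j : ℤ) - 2) / 2 = k - 1 := by omega
    have e2 : ((M i j : ℤ) - 1) / 2 = k - 1 := by omega
    have hz : (S ℝ ((k : ℤ) - 1)).eval (2 * Real.cos θ) = 0 := by
      rw [key]
      have hmk : (M i j : ℝ) = 2 * k := by exact_mod_cast hk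
      have hk0 : (k : ℝ) ≠ 0 := by intro h; rw [h] at hmk; linarith
      have : (((k : ℤ) - 1 : ℤ) + 1 : ℝ) * θ = Real.pi := by
        rw [hθ, hmk]; push_cast; field_simp; ring
      rw [this, Real.sin_pi, zero_div]
    rw [e1, e2, hz]
    simp
  · have e1 : ((M i j : ℤ) - 2) / 2 = k - 1 := by omega
    have e2 : ((M i j : ℤ) - 1) / 2 = k := by omega
    have e3 : ((M i j : ℤ) - 3) / 2 = k - 1 := by omega
    have e4 : ((M i j : ℤ)) / 2 = k := by omega
    have hz : (S ℝ (k : ℤ)).eval (2 * Real.cos θ) +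
        (S ℝ ((k : ℤ) - 1)).eval (2 * Real.cos θ) = 0 := by
      rw [key, key, ← add_div]
      have hmk : (M i j : ℝ) = 2 * k + 1 := by exact_mod_cast hk
      have : (((k : ℤ) - 1 : ℤ) + 1 : ℝ) * θ = 2 * Real.pi - (((k : ℤ) : ℝ) + 1) * θ := by
        have : θ * (2 * k + 1) = 2 * Real.pi := by
          rw [hθ, hmk]; field_simp
        push_cast
        linarith
      rw [this, Real.sin_two_pi_sub, add_neg_cancel, zero_div]
    rw [e1, e2, e3, e4, hz]
    simp

theorem simple_injective : Function.Injective cs.simple := by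
  classical
  intro i j h
  by_contra hij
  have h1 := congrArg (cs.lift ⟨_, isLiftable_reflection M⟩) h
  rw [lift_apply_simple, lift_apply_simple] at h1
  have h2 := congrFun (LinearEquiv.congr_fun h1 (Pi.single j 1)) j
  norm_num [Module.reflection_apply, rootVec, hij] at h2

end Injective

end CoxeterSystem

section Bruhat

variable {B : Type*} {W : Type*} [Group W] {M : CoxeterMatrix B} {cs : CoxeterSystem M W}

theorem bruhatLE_refl (u : W) : bruhatLE cs u u := Relation.ReflTransGen.refl

theorem bruhatLE.trans {u v w : W} (h : bruhatLE cs u v) (h' : bruhatLE cs v w) :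
    bruhatLE cs u w := Relation.ReflTransGen.trans h h'

theorem bruhatLE.eq_or_length_lt {u v : W} (h : bruhatLE cs u v) :
    u = v ∨ cs.length u < cs.length v := by
  induction h with
  | refl => exact Or.inl rfl
  | tail _ h ih =>
    obtain ⟨t, _, rfl, hlt⟩ := h
    right
    rcases ih with rfl | ih
    · exact hlt
    · exact ih.trans hlt

theorem bruhatLE.length_le {u v : W} (h : bruhatLE cs u v) : cs.length u ≤ cs.length v := by
  rcases h.eq_or_length_lt with rfl | h
  · exact le_rfl
  · exact h.le

theorem bruhatLE.eq_of_length_le {u v : W} (h : bruhatLE cs u v)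
    (hl : cs.length v ≤ cs.length u) : u = v := by
  rcases h.eq_or_length_lt with rfl | h
  · rfl
  · omega

theorem bruhatLE_mul_reflection {u t : W} (ht : cs.IsReflection t)
    (h : cs.length u < cs.length (u * t)) : bruhatLE cs u (u * t) :=
  Relation.ReflTransGen.single ⟨t, ht, rfl, h⟩

theorem mul_reflection_bruhatLE {u t : W} (ht : cs.IsReflection t)
    (h : cs.length (u * t) < cs.length u) : bruhatLE cs (u * t) u :=
  Relation.ReflTransGen.single ⟨t, ht, by rw [mul_assoc, ht.mul_self, mul_one], h⟩

theorem bruhatLE_simple_mul {u : W} {i : B} (h : cs.length u < cs.length (cs.simple i * u)) :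
    bruhatLE cs u (cs.simple i * u) := by
  have ht : cs.IsReflection (u⁻¹ * cs.simple i * u) := ⟨u⁻¹, i, by simp⟩
  have he : cs.simple i * u = u * (u⁻¹ * cs.simple i * u) := by simp [mul_assoc]
  rw [he] at h ⊢
  exact bruhatLE_mul_reflection ht h

theorem simple_mul_bruhatLE {u : W} {i : B} (h : cs.IsLeftDescent u i) :
    bruhatLE cs (cs.simple i * u) u := by
  have := bruhatLE_simple_mul (cs := cs) (u := cs.simple i * u) (i := i)
    (by rw [cs.simple_mul_simple_cancel_left]; exact h)
  rwa [cs.simple_mul_simple_cancel_left] at this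

theorem bCov.length_lt {u v : W} (h : bCov cs u v) : cs.length u < cs.length v :=
  h.1.eq_or_length_lt.resolve_left h.2.1

theorem bCov_of_length {u v : W} (h : bruhatLE cs u v) (hl : cs.length v = cs.length u + 1) :
    bCov cs u v := by
  refine ⟨h, fun he => ?_, fun z h1 h2 => ?_⟩
  · rw [he] at hl; omega
  · rcases h1.eq_or_length_lt with h1 | h1
    · exact Or.inl h1.symm
    · exact Or.inr (h2.eq_of_length_le (by omega))

theorem bCov_simple_mul {u : W} {i : B} (h : cs.IsLeftDescent u i) :
    bCov cs (cs.simple i * u) u :=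
  bCov_of_length (simple_mul_bruhatLE h) (cs.isLeftDescent_iff.1 h).symm

theorem bCov_mul_simple {u : W} {i : B} (h : cs.IsRightDescent u i) :
    bCov cs (u * cs.simple i) u :=
  bCov_of_length (mul_reflection_bruhatLE (cs.isReflection_simple i) h)
    (cs.isRightDescent_iff.1 h).symm

theorem not_bCov_one (u : W) : ¬ bCov cs u 1 := by
  intro h
  have := h.length_lt
  simp at this

theorem bruhatLE_exists_coatom {u v : W} (h : bruhatLE cs u v) (hne : u ≠ v) :
    ∃ z, bCov cs z v ∧ bruhatLE cs u z := by
  have hex : ∃ n, ∃ z, bruhatLE cs u z ∧ bruhatLE cs z v ∧ z ≠ v ∧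
      cs.length z + n = cs.length v :=
    ⟨cs.length v - cs.length u, u, bruhatLE_refl u, h, hne, by have := h.length_le; omega⟩
  classical
  obtain ⟨z, h1, h2, h3, h4⟩ := Nat.find_spec hex
  refine ⟨z, ⟨h2, h3, fun y hy1 hy2 => ?_⟩, h1⟩
  by_contra! hc
  have hlt := hy1.eq_or_length_lt.resolve_left hc.1.symm
  have := hy2.length_le
  exact Nat.find_min hex (m := cs.length v - cs.length y) (by omega)
    ⟨y, h1.trans hy1, hy2, hc.2, by omega⟩

theorem length_simple_mul_reflection {u t : W} (i : B) (ht : cs.IsReflection t)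
    (h : cs.length u < cs.length (u * t)) (hne : cs.simple i * u ≠ u * t) :
    cs.length (cs.simple i * u) < cs.length (cs.simple i * (u * t)) := by
  by_contra hn
  have hne' := ht.length_mul_left_ne (cs.simple i * u)
  rw [mul_assoc] at hne'
  have hlt : cs.length (cs.simple i * (u * t)) < cs.length (cs.simple i * u) := by omega
  have h1 := cs.length_simple_mul u i
  have h2 := cs.length_simple_mul (u * t) i
  obtain ⟨ω, hω, rfl⟩ := cs.exists_isReduced u
  rw [← mul_assoc, ← cs.wordProd_cons] at hlt
  obtain ⟨j, hj, he⟩ := cs.strongExchange ht hlt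
  rw [cs.wordProd_cons] at he
  cases j with
  | zero =>
    simp only [List.eraseIdx_cons_zero, mul_assoc] at he
    have h5 := congrArg (fun x => cs.simple i * x) he
    simp only [cs.simple_mul_simple_cancel_left] at h5
    exact hne h5.symm
  | succ j =>
    rw [List.eraseIdx_cons_succ, cs.wordProd_cons, mul_assoc, mul_right_inj] at he
    have h3 := cs.length_wordProd_le (ω.eraseIdx j)
    rw [← he] at h3
    have h4 := List.length_eraseIdx_le ω j
    rw [hω.eq] at h
    omega

theorem bruhatLE.simple_mul_le {x y : W} {i : B} (h : bruhatLE cs x y)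
    (hy : cs.IsLeftDescent y i) : bruhatLE cs (cs.simple i * x) y := by
  have key : bruhatLE cs (cs.simple i * x) (cs.simple i * y) ∨
      bruhatLE cs (cs.simple i * x) y := by
    induction h using Relation.ReflTransGen.head_induction_on with
    | refl => exact Or.inl (bruhatLE_refl _)
    | @head u _ h h' ih =>
      obtain ⟨t, ht, rfl, hlt⟩ := h
      by_cases he : cs.simple i * u = u * t
      · rw [he]; exact Or.inr h'
      · have h1 : bruhatLE cs (cs.simple i * u) (cs.simple i * u * t) :=
          bruhatLE_mul_reflection ht
            (by rw [mul_assoc]; exact length_simple_mul_reflection i ht hlt he)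
        rw [mul_assoc] at h1
        exact ih.imp h1.trans h1.trans
  exact key.elim (fun h => h.trans (simple_mul_bruhatLE hy)) id

theorem bruhatLE.le_simple_mul {x y : W} {i : B} (h : bruhatLE cs x y)
    (hx : ¬ cs.IsLeftDescent x i) :
    bruhatLE cs x (cs.simple i * y) := by
  have key : ∀ y, bruhatLE cs x y → bruhatLE cs (cs.simple i * x) (cs.simple i * y) ∨
      bruhatLE cs x (cs.simple i * y) := by
    intro y h
    induction h with
    | refl => exact Or.inl (bruhatLE_refl _)
    | @tail u _ h' h ih =>
      obtain ⟨t, ht, rfl, hlt⟩ := h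
      by_cases he : cs.simple i * u = u * t
      · rw [← he, cs.simple_mul_simple_cancel_left]; exact Or.inr h'
      · have h1 : bruhatLE cs (cs.simple i * u) (cs.simple i * u * t) :=
          bruhatLE_mul_reflection ht
            (by rw [mul_assoc]; exact length_simple_mul_reflection i ht hlt he)
        rw [mul_assoc] at h1
        exact ih.imp (fun h => h.trans h1) (fun h => h.trans h1)
  have hlt : cs.length x < cs.length (cs.simple i * x) := by
    have := cs.not_isLeftDescent_iff.1 hx
    omega
  exact (key y h).elim (fun h => (bruhatLE_simple_mul hlt).trans h) id

theorem bCov_eq_simple_mul {x y : W} {i : B} (h : bCov cs x y) (hx : ¬ cs.IsLeftDescent x i)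
    (hy : cs.IsLeftDescent y i) : x = cs.simple i * y := by
  have h1 := h.1.le_simple_mul hx
  rcases h.2.2 _ h1 (simple_mul_bruhatLE hy) with h2 | h2
  · exact h2.symm
  · have := cs.isLeftDescent_iff.1 hy
    rw [h2] at this
    omega

theorem one_bruhatLE (u : W) : bruhatLE cs 1 u := by
  induction hn : cs.length u using Nat.strong_induction_on generalizing u with
  | _ n ih =>
    by_cases h : u = 1
    · rw [h]; exact bruhatLE_refl _
    · obtain ⟨i, hi⟩ := cs.exists_leftDescent_of_ne_one h
      exact (ih _ (by rw [← hn]; exact hi) _ rfl).trans (simple_mul_bruhatLE hi)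

theorem eq_of_bruhatLE_of_bCoat_eq {u v : W} (h : bruhatLE cs u v)
    (hc : bCoat cs u = bCoat cs v) : u = v := by
  by_contra hne
  obtain ⟨z, hz, hu⟩ := bruhatLE_exists_coatom h hne
  have hz' : z ∈ bCoat cs u := by rw [hc]; exact hz
  have := bCov.length_lt hz'
  have := hu.length_le
  omega

/-- The standard parabolic subgroup generated by `J`. -/
def parabolic (cs : CoxeterSystem M W) (J : Set B) : Subgroup W :=
  Subgroup.closure (cs.simple '' J)

theorem simple_mem_parabolic {J : Set B} {j : B} (hj : j ∈ J) :
    cs.simple j ∈ parabolic cs J := Subgroup.subset_closure ⟨j, hj, rfl⟩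

theorem simple_mul_mem_parabolic_iff {J : Set B} {j : B} (hj : j ∈ J) {w : W} :
    cs.simple j * w ∈ parabolic cs J ↔ w ∈ parabolic cs J :=
  Subgroup.mul_mem_cancel_left _ (simple_mem_parabolic hj)

theorem wordProd_mem_parabolic {J : Set B} {ω : List B} (h : ∀ b ∈ ω, b ∈ J) :
    cs.wordProd ω ∈ parabolic cs J := by
  induction ω with
  | nil => simp
  | cons i ω ih =>
    rw [cs.wordProd_cons]
    exact Subgroup.mul_mem _ (simple_mem_parabolic (h i (by simp)))
      (ih fun b hb => h b (by simp [hb]))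

theorem mem_parabolic_iff {J : Set B} {w : W} :
    w ∈ parabolic cs J ↔ ∃ ω : List B, (∀ b ∈ ω, b ∈ J) ∧ w = cs.wordProd ω := by
  constructor
  · intro h
    induction h using Subgroup.closure_induction with
    | mem x hx =>
      obtain ⟨j, hj, rfl⟩ := hx
      exact ⟨[j], by simpa using hj, by simp⟩
    | one => exact ⟨[], by simp, by simp⟩
    | mul x y _ _ hx hy =>
      obtain ⟨ω, h1, rfl⟩ := hx
      obtain ⟨ω', h2, rfl⟩ := hy
      refine ⟨ω ++ ω', fun b hb => ?_, by rw [cs.wordProd_append]⟩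
      exact (List.mem_append.1 hb).elim (h1 b) (h2 b)
    | inv x _ hx =>
      obtain ⟨ω, h1, rfl⟩ := hx
      exact ⟨ω.reverse, fun b hb => h1 b (by simpa using hb), by rw [cs.wordProd_reverse]⟩
  · rintro ⟨ω, h, rfl⟩
    exact wordProd_mem_parabolic h

theorem parabolic_ideal {J : Set B} {u v : W} (hv : v ∈ parabolic cs J)
    (h : bruhatLE cs u v) : u ∈ parabolic cs J := by
  induction h using Relation.ReflTransGen.head_induction_on with
  | refl => exact hv
  | @head u _ h _ ih =>
    obtain ⟨t, ht, rfl, hlt⟩ := h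
    obtain ⟨ω, hω, he⟩ := mem_parabolic_iff.1 ih
    have h1 : u = cs.wordProd ω * t := by rw [← he, mul_assoc, ht.mul_self, mul_one]
    rw [he, h1] at hlt
    obtain ⟨j, _, hj⟩ := cs.strongExchange ht hlt
    rw [h1, hj]
    exact wordProd_mem_parabolic fun b hb => hω b (List.mem_of_mem_eraseIdx hb)

theorem exists_leftDescent_of_mem_parabolic {J : Set B} {w : W} (hw : w ∈ parabolic cs J)
    (hne : w ≠ 1) : ∃ j ∈ J, cs.IsLeftDescent w j := by
  classical
  have hex : ∃ n, ∃ ω : List B, ω.length = n ∧ (∀ b ∈ ω, b ∈ J) ∧ w = cs.wordProd ω := by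
    obtain ⟨ω, h1, h2⟩ := mem_parabolic_iff.1 hw
    exact ⟨_, ω, rfl, h1, h2⟩
  obtain ⟨ω, h1, h2, h3⟩ := Nat.find_spec hex
  cases ω with
  | nil => exact absurd h3 (by simpa using hne)
  | cons j ω =>
    refine ⟨j, h2 j (by simp), ?_⟩
    by_contra hd
    have hd' := cs.not_isLeftDescent_iff.1 hd
    rw [cs.wordProd_cons] at h3
    have hv : cs.simple j * w = cs.wordProd ω := by
      rw [h3, cs.simple_mul_simple_cancel_left]
    set v := cs.wordProd ω with hvd
    have ht : cs.IsReflection (v⁻¹ * cs.simple j * v) := ⟨v⁻¹, j, by simp⟩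
    have hw' : v * (v⁻¹ * cs.simple j * v) = w := by rw [h3]; simp [mul_assoc]
    have hlt : cs.length (cs.wordProd ω * (v⁻¹ * cs.simple j * v)) <
        cs.length (cs.wordProd ω) := by
      rw [← hvd, hw', ← hv]; omega
    obtain ⟨k, hk, he⟩ := cs.strongExchange ht hlt
    rw [← hvd, hw'] at he
    refine Nat.find_min hex (m := (ω.eraseIdx k).length) ?_ ⟨_, rfl, ?_, he⟩
    · rw [← h1, List.length_cons]
      have := List.length_eraseIdx_le ω k
      omega
    · exact fun b hb => h2 b (List.mem_cons_of_mem _ (List.mem_of_mem_eraseIdx hb))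

theorem exists_rightDescent_of_mem_parabolic {J : Set B} {w : W} (hw : w ∈ parabolic cs J)
    (hne : w ≠ 1) : ∃ j ∈ J, cs.IsRightDescent w j := by
  obtain ⟨j, hj, h⟩ := exists_leftDescent_of_mem_parabolic (Subgroup.inv_mem _ hw)
    (inv_ne_one.2 hne)
  exact ⟨j, hj, cs.isLeftDescent_inv_iff.1 h⟩

/-- `y` has minimal length in its right coset of the standard parabolic subgroup. -/
def IsMinRep (cs : CoxeterSystem M W) (J : Set B) (y : W) : Prop :=
  ∀ p ∈ parabolic cs J, cs.length y ≤ cs.length (p * y)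

theorem exists_minRep (cs : CoxeterSystem M W) (J : Set B) (w : W) :
    ∃ p ∈ parabolic cs J, ∃ y, IsMinRep cs J y ∧ w = p * y := by
  classical
  have hex : ∃ n, ∃ p ∈ parabolic cs J, cs.length (p * w) = n :=
    ⟨_, 1, Subgroup.one_mem _, rfl⟩
  obtain ⟨p, hp, hn⟩ := Nat.find_spec hex
  refine ⟨p⁻¹, Subgroup.inv_mem _ hp, p * w, fun q hq => ?_, by simp⟩
  rw [hn]
  exact Nat.find_min' hex ⟨q * p, Subgroup.mul_mem _ hq hp, by rw [mul_assoc]⟩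

theorem IsMinRep.length_mul {J : Set B} {y : W} (hy : IsMinRep cs J y) {p : W}
    (hp : p ∈ parabolic cs J) : cs.length (p * y) = cs.length p + cs.length y := by
  induction hn : cs.length p using Nat.strong_induction_on generalizing p with
  | _ n ih =>
    by_cases hp1 : p = 1
    · subst hp1; simp at hn; simp [← hn]
    obtain ⟨j, hj, hd⟩ := exists_leftDescent_of_mem_parabolic hp hp1
    obtain ⟨q, rfl⟩ : ∃ q, p = cs.simple j * q :=
      ⟨cs.simple j * p, by rw [cs.simple_mul_simple_cancel_left]⟩
    have hd' := cs.isLeftDescent_iff.1 hd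
    rw [cs.simple_mul_simple_cancel_left] at hd'
    have hq := (simple_mul_mem_parabolic_iff hj).1 hp
    have hl := ih _ (by omega) hq rfl
    rw [mul_assoc]
    rcases cs.length_simple_mul (q * y) j with h | h
    · omega
    exfalso
    obtain ⟨ω, hω, he⟩ := cs.exists_isReduced q
    obtain ⟨ω', hω', he'⟩ := cs.exists_isReduced y
    set v := q * y with hv
    have hvw : v = cs.wordProd (ω ++ ω') := by rw [cs.wordProd_append, ← he, ← he']
    have ht : cs.IsReflection (v⁻¹ * cs.simple j * v) := ⟨v⁻¹, j, by simp⟩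
    have hw' : v * (v⁻¹ * cs.simple j * v) = cs.simple j * v := by simp [mul_assoc]
    have hlt : cs.length (cs.wordProd (ω ++ ω') * (v⁻¹ * cs.simple j * v)) <
        cs.length (cs.wordProd (ω ++ ω')) := by
      rw [← hvw, hw']; omega
    obtain ⟨k, hk, hke⟩ := cs.strongExchange ht hlt
    rw [← hvw, hw', hv] at hke
    rw [List.length_append] at hk
    by_cases hkω : k < ω.length
    · rw [List.eraseIdx_append_of_lt_length hkω, cs.wordProd_append, ← he', ← mul_assoc,
        mul_left_inj] at hke
      have h1 := cs.length_wordProd_le (ω.eraseIdx k)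
      rw [← hke, List.length_eraseIdx_of_lt hkω, ← hω.eq, ← he] at h1
      omega
    · rw [List.eraseIdx_append_of_length_le (by omega), cs.wordProd_append, ← he] at hke
      have h1 := cs.length_wordProd_le (ω'.eraseIdx (k - ω.length))
      rw [List.length_eraseIdx_of_lt (by omega), ← hω'.eq, ← he'] at h1
      have h2 := hy (q⁻¹ * (cs.simple j * q))
        (Subgroup.mul_mem _ (Subgroup.inv_mem _ hq) hp)
      rw [mul_assoc, mul_assoc, hke, inv_mul_cancel_left] at h2
      have h3 := hω'.eq
      rw [← he'] at h3
      omega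

theorem IsMinRep.unique {J : Set B} {y z p q : W} (hy : IsMinRep cs J y) (hz : IsMinRep cs J z)
    (hp : p ∈ parabolic cs J) (hq : q ∈ parabolic cs J) (h : p * y = q * z) : y = z := by
  have hr : q⁻¹ * p ∈ parabolic cs J := Subgroup.mul_mem _ (Subgroup.inv_mem _ hq) hp
  have h1 : q⁻¹ * p * y = z := by rw [mul_assoc, h, inv_mul_cancel_left]
  have h2 := hy.length_mul hr
  have h3 := hz _ (Subgroup.inv_mem _ hr)
  rw [← h1] at h3
  rw [inv_mul_cancel_left] at h3
  have h4 : cs.length (q⁻¹ * p) = 0 := by omega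
  rw [cs.length_eq_zero_iff.1 h4, one_mul] at h1
  exact h1

theorem IsMinRep.mul_simple {J : Set B} {y : W} (hy : IsMinRep cs J y) {r : B}
    (hr : cs.IsRightDescent y r) : IsMinRep cs J (y * cs.simple r) := by
  intro p hp
  have h1 := hy p hp
  have h2 := cs.length_mul_simple (p * y) r
  have h3 := cs.isRightDescent_iff.1 hr
  rw [← mul_assoc]
  omega

/-- Two elements with the same coatoms and different left descents can be compared through their
minimal coset representatives, by peeling a right descent off the representative of the first. -/
theorem length_minRep_lt_of_bCoat_eq {u v : W} {s t : B} (hc : bCoat cs u = bCoat cs v)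
    (htu : ¬ cs.IsLeftDescent u t) (htv : cs.IsLeftDescent v t) {p q y z : W}
    (hp : p ∈ parabolic cs {s, t}) (hq : q ∈ parabolic cs {s, t})
    (hy : IsMinRep cs {s, t} y) (hz : IsMinRep cs {s, t} z) (hu : u = p * y) (hv : v = q * z)
    (hy1 : y ≠ 1) : cs.length z < cs.length y := by
  obtain ⟨r, hr⟩ := cs.exists_rightDescent_of_ne_one hy1
  have hyr := hy.mul_simple hr
  have ht : cs.simple t ∈ parabolic cs {s, t} := simple_mem_parabolic (by simp)
  have hr' := cs.isRightDescent_iff.1 hr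
  have hx : u * cs.simple r = p * (y * cs.simple r) := by rw [hu, mul_assoc]
  have l1 := hyr.length_mul hp
  have l2 := hy.length_mul hp
  have l3 := hyr.length_mul (Subgroup.mul_mem _ ht hp)
  have l4 := hy.length_mul (Subgroup.mul_mem _ ht hp)
  have hcov : bCov cs (u * cs.simple r) u := by
    refine bCov_mul_simple ?_
    rw [CoxeterSystem.IsRightDescent, hx, hu]; omega
  have hcov' : bCov cs (u * cs.simple r) v := by
    have : u * cs.simple r ∈ bCoat cs v := by rw [← hc]; exact hcov
    exact this
  have hd : ¬ cs.IsLeftDescent (u * cs.simple r) t := by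
    rw [CoxeterSystem.IsLeftDescent, hu] at htu
    rw [CoxeterSystem.IsLeftDescent, hx, ← mul_assoc]
    rw [← mul_assoc] at htu
    omega
  have he := bCov_eq_simple_mul hcov' hd htv
  rw [hx, hv, ← mul_assoc (cs.simple t)] at he
  have := hyr.unique hz hp (Subgroup.mul_mem _ ht hq) he
  rw [← this]
  exact hr

theorem exists_parabolic_of_bCoat_eq {u v : W} (hc : bCoat cs u = bCoat cs v) (hne : u ≠ v) :
    ∃ s t, u ∈ parabolic cs {s, t} ∧ v ∈ parabolic cs {s, t} := by
  have hu1 : u ≠ 1 := fun h => hne (eq_of_bruhatLE_of_bCoat_eq (h ▸ one_bruhatLE v) hc)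
  have hv1 : v ≠ 1 :=
    fun h => hne (eq_of_bruhatLE_of_bCoat_eq (h ▸ one_bruhatLE u) hc.symm).symm
  obtain ⟨s, hs⟩ := cs.exists_leftDescent_of_ne_one hu1
  obtain ⟨t, ht⟩ := cs.exists_leftDescent_of_ne_one hv1
  have aux : ∀ {u v : W} {s : B}, bCoat cs u = bCoat cs v → u ≠ v → cs.IsLeftDescent u s →
      bCov cs (cs.simple s * u) v ∧ ¬ cs.IsLeftDescent v s := by
    intro u v s hc hne hs
    have h1 : cs.simple s * u ∈ bCoat cs v := by rw [← hc]; exact bCov_simple_mul hs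
    refine ⟨h1, fun h => hne (eq_of_bruhatLE_of_bCoat_eq ?_ hc)⟩
    have := bruhatLE.simple_mul_le h1.1 h
    rwa [cs.simple_mul_simple_cancel_left] at this
  obtain ⟨hsu, hsv⟩ := aux hc hne hs
  obtain ⟨htv, htu⟩ := aux hc.symm hne.symm ht
  have hs' : s ∈ ({s, t} : Set B) := by simp
  have ht' : t ∈ ({s, t} : Set B) := by simp
  obtain ⟨p, hp, y, hy, hu⟩ := exists_minRep cs {s, t} u
  obtain ⟨q, hq, z, hz, hv⟩ := exists_minRep cs {s, t} v
  have hor : y = 1 ∨ z = 1 := by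
    by_contra! h
    have h1 := length_minRep_lt_of_bCoat_eq hc htu ht hp hq hy hz hu hv h.1
    have h2 := length_minRep_lt_of_bCoat_eq (s := t) (t := s) hc.symm hsv hs
      (Set.pair_comm s t ▸ hq) (Set.pair_comm s t ▸ hp) (Set.pair_comm s t ▸ hz)
      (Set.pair_comm s t ▸ hy) hv hu h.2
    omega
  refine ⟨s, t, ?_⟩
  rcases hor with h | h
  · have : u ∈ parabolic cs {s, t} := by rw [hu, h, mul_one]; exact hp
    exact ⟨this, (simple_mul_mem_parabolic_iff ht').1 (parabolic_ideal this htv.1)⟩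
  · have : v ∈ parabolic cs {s, t} := by rw [hv, h, mul_one]; exact hq
    exact ⟨(simple_mul_mem_parabolic_iff hs').1 (parabolic_ideal this hsu.1), this⟩

end Bruhat

section Dihedral

variable {B : Type*} {W : Type*} [Group W] {M : CoxeterMatrix B} {cs : CoxeterSystem M W}

theorem mem_of_simple_mem_parabolic {J : Set B} {i : B} (h : cs.simple i ∈ parabolic cs J) :
    i ∈ J := by
  have hne : cs.simple i ≠ 1 := by
    intro h1
    have := cs.length_simple i
    rw [h1, cs.length_one] at this
    omega
  obtain ⟨j, hj, hd⟩ := exists_leftDescent_of_mem_parabolic h hne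
  have h1 := cs.isLeftDescent_iff.1 hd
  rw [cs.length_simple] at h1
  have h2 : cs.simple j * cs.simple i = 1 := cs.length_eq_zero_iff.1 (by omega)
  have h3 : cs.simple j = cs.simple i := by
    rw [eq_inv_of_mul_eq_one_left h2, cs.inv_simple]
  exact cs.simple_injective h3 ▸ hj

theorem simple_bruhatLE {w : W} {i : B} (h : cs.IsLeftDescent w i) :
    bruhatLE cs (cs.simple i) w := by
  simpa using (one_bruhatLE w).simple_mul_le h

theorem mem_of_leftDescent {J : Set B} {w : W} {i : B} (hw : w ∈ parabolic cs J)
    (h : cs.IsLeftDescent w i) : i ∈ J :=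
  mem_of_simple_mem_parabolic (parabolic_ideal hw (simple_bruhatLE h))

theorem not_isLeftDescent_simple_mul {w : W} {i : B} (h : cs.IsLeftDescent w i) :
    ¬ cs.IsLeftDescent (cs.simple i * w) i :=
  cs.isLeftDescent_iff_not_isLeftDescent_mul.1 h

variable {s t : B}

theorem eq_of_length_eq_of_leftDescent {u v : W} (hu : u ∈ parabolic cs {s, t})
    (hv : v ∈ parabolic cs {s, t}) (hl : cs.length u = cs.length v) {j : B}
    (hju : cs.IsLeftDescent u j) (hjv : cs.IsLeftDescent v j) : u = v := by
  induction hn : cs.length u using Nat.strong_induction_on generalizing u v j with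
  | _ n ih =>
    have hj := mem_of_leftDescent hu hju
    have hu' := (simple_mul_mem_parabolic_iff hj).2 hu
    have hv' := (simple_mul_mem_parabolic_iff hj).2 hv
    have h1 := cs.isLeftDescent_iff.1 hju
    have h2 := cs.isLeftDescent_iff.1 hjv
    have hl' : cs.length (cs.simple j * u) = cs.length (cs.simple j * v) := by omega
    suffices cs.simple j * u = cs.simple j * v from mul_left_cancel this
    by_cases h : cs.simple j * u = 1
    · rw [h, cs.length_one] at hl'
      rw [h, cs.length_eq_zero_iff.1 hl'.symm]
    · have h' : cs.simple j * v ≠ 1 := by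
        intro h'
        rw [h', cs.length_one] at hl'
        exact h (cs.length_eq_zero_iff.1 hl')
      obtain ⟨k, hk, hkd⟩ := exists_leftDescent_of_mem_parabolic hu' h
      obtain ⟨k', hk', hkd'⟩ := exists_leftDescent_of_mem_parabolic hv' h'
      have hkj : k ≠ j := fun e => not_isLeftDescent_simple_mul hju (e ▸ hkd)
      have hkj' : k' ≠ j := fun e => not_isLeftDescent_simple_mul hjv (e ▸ hkd')
      have : k' = k := by
        simp only [Set.mem_insert_iff, Set.mem_singleton_iff] at hj hk hk'
        grind
      subst this
      exact ih _ (by omega) hu' hv' hl' hkd hkd' rfl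

theorem eq_or_eq_of_length_eq {x y z : W} (hx : x ∈ parabolic cs {s, t})
    (hy : y ∈ parabolic cs {s, t}) (hz : z ∈ parabolic cs {s, t}) (hyz : y ≠ z)
    (hxy : cs.length x = cs.length y) (hxz : cs.length x = cs.length z) : x = y ∨ x = z := by
  by_cases h1 : x = 1
  · left
    rw [h1, cs.length_one] at hxy
    rw [h1, cs.length_eq_zero_iff.1 hxy.symm]
  have hpos : cs.length x ≠ 0 := fun h => h1 (cs.length_eq_zero_iff.1 h)
  have hy1 : y ≠ 1 := by rintro rfl; simp at hxy; exact h1 hxy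
  have hz1 : z ≠ 1 := by rintro rfl; simp at hxz; exact h1 hxz
  obtain ⟨i, hi, hix⟩ := exists_leftDescent_of_mem_parabolic hx h1
  obtain ⟨j, hj, hjy⟩ := exists_leftDescent_of_mem_parabolic hy hy1
  obtain ⟨k, hk, hkz⟩ := exists_leftDescent_of_mem_parabolic hz hz1
  have hjk : j ≠ k := by
    rintro rfl
    exact hyz (eq_of_length_eq_of_leftDescent hy hz (by omega) hjy hkz)
  have : i = j ∨ i = k := by
    simp only [Set.mem_insert_iff, Set.mem_singleton_iff] at hi hj hk
    grind
  rcases this with rfl | rfl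
  · exact Or.inl (eq_of_length_eq_of_leftDescent hx hy hxy hix hjy)
  · exact Or.inr (eq_of_length_eq_of_leftDescent hx hz hxz hix hkz)

theorem bruhatLE_of_length_lt {u v : W} (hu : u ∈ parabolic cs {s, t})
    (hv : v ∈ parabolic cs {s, t}) (hl : cs.length u < cs.length v) : bruhatLE cs u v := by
  induction hn : cs.length v using Nat.strong_induction_on generalizing u v with
  | _ n ih =>
    by_cases hu1 : u = 1
    · rw [hu1]; exact one_bruhatLE v
    have hv1 : v ≠ 1 := by rintro rfl; simp at hl
    obtain ⟨j, hj, hjv⟩ := exists_leftDescent_of_mem_parabolic hv hv1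
    obtain ⟨k, hk, hku⟩ := exists_leftDescent_of_mem_parabolic hu hu1
    have hv' := (simple_mul_mem_parabolic_iff hj).2 hv
    have h1 := cs.isLeftDescent_iff.1 hjv
    have h2 := cs.isLeftDescent_iff.1 hku
    have hle := simple_mul_bruhatLE hjv
    by_cases hkj : k = j
    · subst hkj
      have hu' := (simple_mul_mem_parabolic_iff hk).2 hu
      have := (ih _ (by omega) hu' hv' (by omega) rfl).trans hle
      have := this.simple_mul_le hjv
      rwa [cs.simple_mul_simple_cancel_left] at this
    · rcases Nat.lt_or_ge (cs.length u) (cs.length (cs.simple j * v)) with h | h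
      · exact (ih _ (by omega) hu hv' h rfl).trans hle
      · have hpos : cs.simple j * v ≠ 1 := by
          intro e; rw [e, cs.length_one] at h1; omega
        obtain ⟨m, hm, hmv⟩ := exists_leftDescent_of_mem_parabolic hv' hpos
        have hmj : m ≠ j := fun e => not_isLeftDescent_simple_mul hjv (e ▸ hmv)
        have : m = k := by
          simp only [Set.mem_insert_iff, Set.mem_singleton_iff] at hj hk hm
          grind
        subst this
        rw [eq_of_length_eq_of_leftDescent hu hv' (by omega) hku hmv]
        exact hle

theorem bCov_iff_of_mem_parabolic {u v : W} (hu : u ∈ parabolic cs {s, t})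
    (hv : v ∈ parabolic cs {s, t}) : bCov cs u v ↔ cs.length v = cs.length u + 1 := by
  constructor
  · intro h
    have hlt := h.length_lt
    have hv1 : v ≠ 1 := by rintro rfl; simp at hlt
    obtain ⟨j, hj, hjv⟩ := exists_leftDescent_of_mem_parabolic hv hv1
    have h1 := cs.isLeftDescent_iff.1 hjv
    by_contra hne
    have hle := bruhatLE_of_length_lt hu ((simple_mul_mem_parabolic_iff hj).2 hv)
      (by omega)
    rcases h.2.2 _ hle (simple_mul_bruhatLE hjv) with e | e
    · rw [e] at h1; omega
    · rw [e] at h1; omega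
  · intro h
    exact bCov_of_length (bruhatLE_of_length_lt hu hv (by omega)) h

theorem exists_mem_parabolic_length_eq {J : Set B} {x : W} (hx : x ∈ parabolic cs J) {n : ℕ}
    (hn : n ≤ cs.length x) : ∃ y ∈ parabolic cs J, cs.length y = n := by
  induction hm : cs.length x using Nat.strong_induction_on generalizing x with
  | _ m ih =>
    rcases hn.eq_or_lt with h | h
    · exact ⟨x, hx, h.symm⟩
    have hx1 : x ≠ 1 := by rintro rfl; simp at h
    obtain ⟨j, hj, hd⟩ := exists_leftDescent_of_mem_parabolic hx hx1
    have h1 := cs.isLeftDescent_iff.1 hd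
    exact ih _ (by omega) ((simple_mul_mem_parabolic_iff hj).2 hx) (by omega) rfl

theorem exists_pair_of_length_gt {J : Set B} {x : W} (hx : x ∈ parabolic cs J) {n : ℕ}
    (hn : 0 < n) (hnx : n < cs.length x) :
    ∃ y ∈ parabolic cs J, ∃ z ∈ parabolic cs J, y ≠ z ∧ cs.length y = n ∧ cs.length z = n := by
  obtain ⟨x, hx, hl⟩ := exists_mem_parabolic_length_eq hx (n := n + 1) hnx
  have hx1 : x ≠ 1 := by rintro rfl; simp at hl
  obtain ⟨j, hj, hd⟩ := exists_leftDescent_of_mem_parabolic hx hx1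
  have h1 := cs.isLeftDescent_iff.1 hd
  have hy := (simple_mul_mem_parabolic_iff hj).2 hx
  have hy1 : cs.simple j * x ≠ 1 := by intro e; rw [e, cs.length_one] at h1; omega
  obtain ⟨r, hr, hrd⟩ := exists_rightDescent_of_mem_parabolic hy hy1
  have h2 := cs.isRightDescent_iff.1 hrd
  rw [mul_assoc] at h2
  have h3 := cs.length_simple_mul (x * cs.simple r) j
  have h4 := cs.length_mul_simple x r
  refine ⟨_, hy, x * cs.simple r, Subgroup.mul_mem _ hx (simple_mem_parabolic hr), fun e => ?_,
    by omega, by omega⟩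
  rw [← e, cs.simple_mul_simple_cancel_left] at h2
  omega

theorem eq_one_or_eq_simple_of_mem {a : B} {x : W} (hst : s ≠ t)
    (hs : x ∈ parabolic cs {s, a}) (ht : x ∈ parabolic cs {t, a}) : x = 1 ∨ x = cs.simple a := by
  have key : ∀ {x : W} {i : B}, x ∈ parabolic cs {s, a} → x ∈ parabolic cs {t, a} →
      cs.IsLeftDescent x i → i = a := by
    intro x i h1 h2 hi
    have h3 := mem_of_leftDescent h1 hi
    have h4 := mem_of_leftDescent h2 hi
    simp only [Set.mem_insert_iff, Set.mem_singleton_iff] at h3 h4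
    grind
  by_cases h1 : x = 1
  · exact Or.inl h1
  obtain ⟨i, hi⟩ := cs.exists_leftDescent_of_ne_one h1
  obtain rfl := key hs ht hi
  by_cases h2 : cs.simple i * x = 1
  · right
    rw [eq_inv_of_mul_eq_one_right h2, cs.inv_simple]
  obtain ⟨k, hk⟩ := cs.exists_leftDescent_of_ne_one h2
  have hmem : ∀ r : B, i ∈ ({r, i} : Set B) := fun r => by simp
  obtain rfl := key ((simple_mul_mem_parabolic_iff (hmem s)).2 hs)
    ((simple_mul_mem_parabolic_iff (hmem t)).2 ht) hk
  exact absurd hk (not_isLeftDescent_simple_mul hi)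

end Dihedral

section Matchings

variable {B : Type*} {W : Type*} [Group W] {M : CoxeterMatrix B} {cs : CoxeterSystem M W}

theorem dihedral_eq_parabolic (s t : B) :
    dihedral cs s t = (parabolic cs {s, t} : Set W) := by
  rw [dihedral, parabolic, Set.image_pair]

theorem mem_dihedral {s t : B} {x : W} : x ∈ dihedral cs s t ↔ x ∈ parabolic cs {s, t} := by
  rw [dihedral_eq_parabolic]; rfl

/-- If all coatoms of `w` lie in a standard parabolic subgroup, then so does `w`. -/
theorem mem_parabolic_of_forall_bCov {J : Set B} {w : W} (hl : 2 ≤ cs.length w)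
    (h : ∀ x, bCov cs x w → x ∈ parabolic cs J) : w ∈ parabolic cs J := by
  have hw1 : w ≠ 1 := by rintro rfl; simp at hl
  obtain ⟨i, hi⟩ := cs.exists_leftDescent_of_ne_one hw1
  have h1 := cs.isLeftDescent_iff.1 hi
  have hx := h _ (bCov_simple_mul hi)
  have hx1 : cs.simple i * w ≠ 1 := by intro e; rw [e, cs.length_one] at h1; omega
  obtain ⟨r, hr⟩ := cs.exists_rightDescent_of_ne_one hx1
  have h2 := cs.isRightDescent_iff.1 hr
  have h3 := cs.length_simple_mul (w * cs.simple r) i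
  rw [← mul_assoc] at h3
  have hwr : cs.IsRightDescent w r := by rw [CoxeterSystem.IsRightDescent]; omega
  have h4 := h _ (bCov_mul_simple hwr)
  have h5 := parabolic_ideal hx (bCov_mul_simple hr).1
  have h6 := Subgroup.mul_mem _ (Subgroup.mul_mem _ h4 (Subgroup.inv_mem _ h5)) hx
  have h7 : w * cs.simple r * (cs.simple i * w * cs.simple r)⁻¹ * (cs.simple i * w) = w := by
    group
  rwa [h7] at h6

namespace BSM

/-- The restriction of a partial special matching to a stable order ideal. -/
def restrict (φ : BSM cs) (I : Set W) (hI : ∀ x y, y ∈ I → bruhatLE cs x y → x ∈ I)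
    (hφ : ∀ x ∈ φ.dom, x ∈ I → φ.toFun x ∈ I) : BSM cs where
  dom := φ.dom ∩ I
  toFun := φ.toFun
  ideal := fun x y hy h => ⟨φ.ideal hy.1 h, hI x y hy.2 h⟩
  maps := fun x hx => ⟨φ.maps x hx.1, hφ x hx.1 hx.2⟩
  invol := fun x hx => φ.invol x hx.1
  cov := fun x hx => φ.cov x hx.1
  coatom := fun x hx => φ.coatom x hx.1

/-- Partial special matchings that agree on the intersections of their domains glue to a partial
special matching on the union of the domains. -/
theorem exists_union (F : Set (BSM cs))
    (hF : ∀ ψ ∈ F, ∀ ψ' ∈ F, ∀ x, x ∈ ψ.dom → x ∈ ψ'.dom → ψ.toFun x = ψ'.toFun x) :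
    ∃ φ : BSM cs, (∀ x, x ∈ φ.dom ↔ ∃ ψ ∈ F, x ∈ ψ.dom) ∧
      ∀ ψ ∈ F, ∀ x ∈ ψ.dom, φ.toFun x = ψ.toFun x := by
  classical
  let f : W → W := fun x =>
    if h : ∃ ψ ∈ F, x ∈ ψ.dom then h.choose.toFun x else x
  have hf : ∀ ψ ∈ F, ∀ x ∈ ψ.dom, f x = ψ.toFun x := by
    intro ψ hψ x hx
    have h : ∃ ψ ∈ F, x ∈ ψ.dom := ⟨ψ, hψ, hx⟩
    simp only [f, dif_pos h]
    exact hF _ h.choose_spec.1 _ hψ x h.choose_spec.2 hx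
  refine ⟨⟨{x | ∃ ψ ∈ F, x ∈ ψ.dom}, f, ?_, ?_, ?_, ?_, ?_⟩, fun x => Iff.rfl, hf⟩
  · rintro x y ⟨ψ, hψ, hy⟩ h
    exact ⟨ψ, hψ, ψ.ideal hy h⟩
  · rintro x ⟨ψ, hψ, hx⟩
    exact ⟨ψ, hψ, by rw [hf ψ hψ x hx]; exact ψ.maps x hx⟩
  · rintro x ⟨ψ, hψ, hx⟩
    rw [hf ψ hψ x hx, hf ψ hψ _ (ψ.maps x hx), ψ.invol x hx]
  · rintro x ⟨ψ, hψ, hx⟩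
    rw [hf ψ hψ x hx]
    exact ψ.cov x hx
  · rintro u ⟨ψ, hψ, hu⟩ hc
    rw [hf ψ hψ u hu] at hc ⊢
    rw [ψ.coatom u hu hc]
    congr 1
    ext w
    refine exists_congr fun v => and_congr_right fun hv => ?_
    rw [hf ψ hψ v (ψ.ideal hu hv.1)]

theorem bCov_toFun_one (φ : BSM cs) (h : 1 ∈ φ.dom) : bCov cs 1 (φ.toFun 1) :=
  (φ.cov 1 h).resolve_left (not_bCov_one _)

theorem toFun_mem_parabolic (φ : BSM cs) {a : B} (h1 : φ.toFun 1 = cs.simple a) {J : Set B}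
    (ha : a ∈ J) {u : W} (hu : u ∈ φ.dom) (huJ : u ∈ parabolic cs J) :
    φ.toFun u ∈ parabolic cs J := by
  induction hn : cs.length u using Nat.strong_induction_on generalizing u with
  | _ n ih =>
    by_cases hu1 : u = 1
    · rw [hu1, h1]; exact simple_mem_parabolic ha
    rcases φ.cov u hu with h | h
    · exact parabolic_ideal huJ h.1
    have hpos : cs.length u ≠ 0 := fun e => hu1 (cs.length_eq_zero_iff.1 e)
    have hlt := h.length_lt
    refine mem_parabolic_of_forall_bCov (by omega) fun x hx => ?_
    have hx' : x ∈ bCoat cs (φ.toFun u) := hx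
    rw [φ.coatom u hu h] at hx'
    rcases hx' with rfl | ⟨v, hv, _, rfl⟩
    · exact huJ
    · exact ih _ (by rw [← hn]; exact hv.length_lt) (φ.ideal hu hv.1)
        (parabolic_ideal huJ hv.1) rfl

theorem simple_bruhatLE_toFun (φ : BSM cs) {a : B} (h1 : φ.toFun 1 = cs.simple a) {u : W}
    (hu : u ∈ φ.dom) (hc : bCov cs u (φ.toFun u)) :
    bruhatLE cs (cs.simple a) (φ.toFun u) := by
  induction hn : cs.length u using Nat.strong_induction_on generalizing u with
  | _ n ih =>
    by_cases hu1 : u = 1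
    · rw [hu1, h1]; exact bruhatLE_refl _
    obtain ⟨v, hv, -⟩ := bruhatLE_exists_coatom (one_bruhatLE u) (Ne.symm hu1)
    have hvd := φ.ideal hu hv.1
    have hlt := hv.length_lt
    rcases φ.cov v hvd with h | h
    · have hlt' := h.length_lt
      have h2 : bCov cs (φ.toFun v) (φ.toFun (φ.toFun v)) := by rwa [φ.invol v hvd]
      have h3 := ih _ (by omega) (φ.maps v hvd) h2 rfl
      rw [φ.invol v hvd] at h3
      exact (h3.trans hv.1).trans hc.1
    · have h2 : φ.toFun v ∈ bCoat cs (φ.toFun u) := by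
        rw [φ.coatom u hu hc]
        exact Or.inr ⟨v, hv, h, rfl⟩
      exact (ih _ (by omega) hvd h rfl).trans h2.1

/-- Partial special matchings sending `1` to `a` are determined by their values on the principal
dihedral subgroups. -/
theorem toFun_eq_of_agree {φ φ' : BSM cs} {a : B} (h1 : φ.toFun 1 = cs.simple a)
    (h1' : φ'.toFun 1 = cs.simple a)
    (hagree : ∀ s, s ≠ a → ∀ u ∈ parabolic cs {s, a}, u ∈ φ.dom → u ∈ φ'.dom →
      φ.toFun u = φ'.toFun u) {u : W} (hu : u ∈ φ.dom) (hu' : u ∈ φ'.dom) :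
    φ.toFun u = φ'.toFun u := by
  induction hn : cs.length u using Nat.strong_induction_on generalizing u with
  | _ n ih =>
    have ih' : ∀ v, bCov cs v u → φ.toFun v = φ'.toFun v := fun v hv =>
      ih _ (by rw [← hn]; exact hv.length_lt) (φ.ideal hu hv.1) (φ'.ideal hu' hv.1) rfl
    by_cases hu1 : u = 1
    · rw [hu1, h1, h1']
    rcases φ.cov u hu with h | h
    · have h2 := ih' _ h
      rw [φ.invol u hu] at h2
      have h3 := φ'.invol _ (φ'.ideal hu' h.1)
      rw [← h2] at h3
      exact h3.symm
    rcases φ'.cov u hu' with h' | h'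
    · have h2 := ih' _ h'
      rw [φ'.invol u hu'] at h2
      have h3 := φ.invol _ (φ.ideal hu h'.1)
      rw [h2] at h3
      exact h3
    by_contra hne
    have hcoat : bCoat cs (φ.toFun u) = bCoat cs (φ'.toFun u) := by
      rw [φ.coatom u hu h, φ'.coatom u hu' h']
      congr 1
      ext w
      refine exists_congr fun v => and_congr_right fun hv => ?_
      rw [ih' v hv]
    obtain ⟨s, t, hst, -⟩ := exists_parabolic_of_bCoat_eq hcoat hne
    have ha := mem_of_simple_mem_parabolic
      (parabolic_ideal hst (φ.simple_bruhatLE_toFun h1 hu h))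
    obtain ⟨r, hr⟩ : ∃ r, ({s, t} : Set B) = {r, a} := by
      rcases ha with rfl | ha
      · exact ⟨t, Set.pair_comm _ _⟩
      · rw [Set.mem_singleton_iff] at ha
        exact ⟨s, by rw [ha]⟩
    rw [hr] at hst
    have hur := parabolic_ideal hst h.1
    by_cases hra : r = a
    · subst hra
      have hlt := h.length_lt
      have hpos : cs.length u ≠ 0 := fun e => hu1 (cs.length_eq_zero_iff.1 e)
      have hw1 : φ.toFun u ≠ 1 := by intro e; rw [e, cs.length_one] at hlt; omega
      obtain ⟨i, hi, hid⟩ := exists_leftDescent_of_mem_parabolic hst hw1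
      have h2 := cs.isLeftDescent_iff.1 hid
      have hw2 : cs.simple i * φ.toFun u ≠ 1 := by
        intro e; rw [e, cs.length_one] at h2; omega
      obtain ⟨k, hk, hkd⟩ := exists_leftDescent_of_mem_parabolic
        ((simple_mul_mem_parabolic_iff hi).2 hst) hw2
      have : k = i := by
        simp only [Set.mem_insert_iff, Set.mem_singleton_iff] at hi hk
        grind
      subst this
      exact not_isLeftDescent_simple_mul hid hkd
    · exact hne (hagree r hra u hur hu hu')

theorem existsUnique_bCov_toFun (φ : BSM cs) {s a : B} (h1 : φ.toFun 1 = cs.simple a) (n : ℕ)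
    (hdom : ∀ x ∈ parabolic cs {s, a}, cs.length x ≤ n → x ∈ φ.dom)
    (hn : ∃ x ∈ parabolic cs {s, a}, n < cs.length x) :
    ∃ c ∈ parabolic cs {s, a}, cs.length c = n ∧ bCov cs c (φ.toFun c) ∧
      ∀ d ∈ parabolic cs {s, a}, cs.length d = n → bCov cs d (φ.toFun d) → d = c := by
  have hstab : ∀ x ∈ parabolic cs {s, a}, x ∈ φ.dom → φ.toFun x ∈ parabolic cs {s, a} :=
    fun x hx hxd => φ.toFun_mem_parabolic h1 (by simp) hxd hx
  induction n with
  | zero =>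
    have hmem : (1 : W) ∈ φ.dom := hdom 1 (Subgroup.one_mem _) (by simp)
    exact ⟨1, Subgroup.one_mem _, cs.length_one, φ.bCov_toFun_one hmem,
      fun d _ hd _ => cs.length_eq_zero_iff.1 hd⟩
  | succ n ih =>
    obtain ⟨x, hx, hnx⟩ := hn
    obtain ⟨c, hc, hcl, hcc, hcu⟩ := ih (fun x hx h => hdom x hx (by omega))
      ⟨x, hx, by omega⟩
    have hcd := hdom c hc (by omega)
    have hw := hstab c hc hcd
    have hwl := (bCov_iff_of_mem_parabolic hc hw).1 hcc
    rw [hcl] at hwl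
    obtain ⟨w', hw', hw'l, hne⟩ : ∃ w' ∈ parabolic cs {s, a}, cs.length w' = n + 1 ∧
        w' ≠ φ.toFun c := by
      obtain ⟨y, hy, z, hz, hyz, hyl, hzl⟩ := exists_pair_of_length_gt hx n.succ_pos hnx
      by_cases h : y = φ.toFun c
      · exact ⟨z, hz, hzl, fun e => hyz (h.trans e.symm)⟩
      · exact ⟨y, hy, hyl, h⟩
    have hw'd := hdom w' hw' hw'l.le
    refine ⟨w', hw', hw'l, (φ.cov w' hw'd).resolve_left fun h => hne ?_, fun d hd hdl hdc => ?_⟩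
    · have hl := (bCov_iff_of_mem_parabolic (hstab w' hw' hw'd) hw').1 h
      have := hcu _ (hstab w' hw' hw'd) (by omega) (by rwa [φ.invol w' hw'd])
      rw [← this, φ.invol w' hw'd]
    · refine (eq_or_eq_of_length_eq hd hw' hw hne (by omega) (by omega)).resolve_right ?_
      rintro rfl
      rw [φ.invol c hcd] at hdc
      have := hdc.length_lt
      omega

/-- A partial special matching extends by a new pair `x ⋖ y`, provided the domain stays an order
ideal and the coatom condition holds at `x`. -/
theorem exists_extension (φ : BSM cs) {x y : W} (hx : x ∉ φ.dom) (hy : y ∉ φ.dom)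
    (hxy : bCov cs x y) (hix : ∀ z, bruhatLE cs z x → z = x ∨ z ∈ φ.dom)
    (hiy : ∀ z, bruhatLE cs z y → z = y ∨ z = x ∨ z ∈ φ.dom)
    (hc : bCoat cs y =
      {x} ∪ {w | ∃ v, bCov cs v x ∧ bCov cs v (φ.toFun v) ∧ w = φ.toFun v}) :
    ∃ ψ : BSM cs, BExtends ψ φ ∧ x ∈ ψ.dom := by
  classical
  let f : W → W := fun z => if z = x then y else if z = y then x else φ.toFun z
  have hne : y ≠ x := hxy.2.1.symm
  have hfx : f x = y := by simp [f]
  have hfy : f y = x := by simp [f, hne]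
  have hf : ∀ z ∈ φ.dom, f z = φ.toFun z := by
    intro z hz
    have h1 : z ≠ x := fun e => hx (e ▸ hz)
    have h2 : z ≠ y := fun e => hy (e ▸ hz)
    simp [f, h1, h2]
  refine ⟨⟨{z | z = x ∨ z = y ∨ z ∈ φ.dom}, f, ?_, ?_, ?_, ?_, ?_⟩,
    ⟨fun z hz => Or.inr (Or.inr hz), hf⟩, Or.inl rfl⟩
  · rintro z u (rfl | rfl | hu) h
    · exact (hix z h).imp_right Or.inr
    · rcases hiy z h with h | h | h
      · exact Or.inr (Or.inl h)
      · exact Or.inl h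
      · exact Or.inr (Or.inr h)
    · exact Or.inr (Or.inr (φ.ideal hu h))
  · rintro z (rfl | rfl | hz)
    · exact Or.inr (Or.inl hfx)
    · exact Or.inl hfy
    · exact Or.inr (Or.inr (by rw [hf z hz]; exact φ.maps z hz))
  · rintro z (rfl | rfl | hz)
    · rw [hfx, hfy]
    · rw [hfy, hfx]
    · rw [hf z hz, hf _ (φ.maps z hz), φ.invol z hz]
  · rintro z (rfl | rfl | hz)
    · rw [hfx]; exact Or.inr hxy
    · rw [hfy]; exact Or.inl hxy
    · rw [hf z hz]; exact φ.cov z hz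
  · rintro u (rfl | rfl | hu) hcu
    · rw [hfx, hc]
      congr 1
      ext w
      refine exists_congr fun v => and_congr_right fun hv => ?_
      rw [hf v ((hix v hv.1).resolve_left hv.2.1)]
    · rw [hfy] at hcu
      have := hcu.length_lt
      have := hxy.length_lt
      omega
    · rw [hf u hu] at hcu ⊢
      rw [φ.coatom u hu hcu]
      congr 1
      ext w
      refine exists_congr fun v => and_congr_right fun hv => ?_
      rw [hf v (φ.ideal hu hv.1)]

theorem parabolic_subset_dom {φ : BSM cs} (hmax : BMax φ) {a : B} (h0 : 1 ∈ φ.dom)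
    (h1 : φ.toFun 1 = cs.simple a) (s : B) : (parabolic cs {s, a} : Set W) ⊆ φ.dom := by
  classical
  by_contra hsub
  obtain ⟨x₀, hx₀, hx₀d⟩ := Set.not_subset.1 hsub
  have hex : ∃ m, ∃ x ∈ parabolic cs {s, a}, x ∉ φ.dom ∧ cs.length x = m :=
    ⟨_, x₀, hx₀, hx₀d, rfl⟩
  obtain ⟨x, hx, hxd, hxm⟩ := Nat.find_spec hex
  have hmin : ∀ z ∈ parabolic cs {s, a}, cs.length z < cs.length x → z ∈ φ.dom := by
    intro z hz hlt
    by_contra hzd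
    exact Nat.find_min hex (by rwa [← hxm]) ⟨z, hz, hzd, rfl⟩
  clear hxm
  have hx1 : x ≠ 1 := fun e => hxd (e ▸ h0)
  have hxpos : cs.length x ≠ 0 := fun e => hx1 (cs.length_eq_zero_iff.1 e)
  obtain ⟨n, hn⟩ := Nat.exists_eq_succ_of_ne_zero hxpos
  obtain ⟨c, hc, hcl, hcc, hcu⟩ := φ.existsUnique_bCov_toFun h1 n
    (fun z hz hl => hmin z hz (by omega)) ⟨x, hx, by omega⟩
  have hcd := hmin c hc (by omega)
  have hw := φ.toFun_mem_parabolic h1 (by simp) hcd hc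
  have hwd := φ.maps c hcd
  have hwl := (bCov_iff_of_mem_parabolic hc hw).1 hcc
  have hxw : x ≠ φ.toFun c := fun e => hxd (e ▸ hwd)
  have hw1 : φ.toFun c ≠ 1 := by intro e; rw [e, cs.length_one] at hwl; omega
  obtain ⟨j, hj, hjw⟩ := exists_leftDescent_of_mem_parabolic hw hw1
  have hjx : ¬ cs.IsLeftDescent x j := fun h =>
    hxw (eq_of_length_eq_of_leftDescent hx hw (by omega) h hjw)
  have hyl := cs.not_isLeftDescent_iff.1 hjx
  have hy := (simple_mul_mem_parabolic_iff hj).2 hx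
  have hxy := (bCov_iff_of_mem_parabolic hx hy).2 hyl
  have hyd : cs.simple j * x ∉ φ.dom := fun h => hxd (φ.ideal h hxy.1)
  have hlen : ∀ z ∈ parabolic cs {s, a}, cs.length z = n + 1 → z = x ∨ z = φ.toFun c :=
    fun z hz hzl => eq_or_eq_of_length_eq hz hx hw hxw (by omega) (by omega)
  obtain ⟨ψ, hψ, hxψ⟩ := φ.exists_extension hxd hyd hxy
    (fun z hz => hz.eq_or_length_lt.imp_right (hmin z (parabolic_ideal hx hz)))
    (fun z hz => hz.eq_or_length_lt.imp_right fun hlt => by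
      have hzP := parabolic_ideal hy hz
      rcases Nat.lt_or_ge (cs.length z) (cs.length x) with h | h
      · exact Or.inr (hmin z hzP h)
      · exact (hlen z hzP (by omega)).imp_right fun (e : z = φ.toFun c) => e ▸ hwd)
    (by
      ext z
      constructor
      · intro hz
        have hzP := parabolic_ideal hy (show bCov cs z _ from hz).1
        have hzl := (bCov_iff_of_mem_parabolic hzP hy).1 hz
        refine (hlen z hzP (by omega)).imp_right fun e => ⟨c, ?_, hcc, e⟩
        exact (bCov_iff_of_mem_parabolic hc hx).2 (by omega)
      · rintro (rfl | ⟨v, hv, hvc, rfl⟩)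
        · exact hxy
        · have hvP := parabolic_ideal hx hv.1
          have hvl := (bCov_iff_of_mem_parabolic hvP hx).1 hv
          rw [hcu v hvP (by omega) hvc]
          exact (bCov_iff_of_mem_parabolic hw hy).2 (by omega))
  rw [hmax ψ hψ] at hxψ
  exact hxd hxψ

theorem toFun_one_of_subsingleton (φ : BSM cs) {a : B} (h : ∀ s, s = a) (h0 : 1 ∈ φ.dom) :
    φ.toFun 1 = cs.simple a := by
  have hc := φ.bCov_toFun_one h0
  obtain ⟨i, hi⟩ := cs.exists_leftDescent_of_ne_one hc.2.1.symm
  obtain rfl := h i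
  have h1 := bCov_simple_mul hi
  rcases hc.2.2 _ (one_bruhatLE _) h1.1 with e | e
  · rw [eq_inv_of_mul_eq_one_right e, cs.inv_simple]
  · exact absurd e h1.2.1

end BSM

end Matchings
/-- restriction gives a bijection between maximal partial special matchings
`φ` of `W` with `φ(e) = a` and families of special matchings of the principal dihedral
subgroups `P_s = ⟨s,a⟩` sending `e` to `a`: every maximal matching restricts to such a
family, and every such family extends uniquely to a maximal matching. -/
theorem stmt7 {B : Type*} {W : Type*} [Group W] {M : CoxeterMatrix B}
    (cs : CoxeterSystem M W) (a : B) :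
    (∀ φ : BSM cs, BMax φ → (1 : W) ∈ φ.dom → φ.toFun 1 = cs.simple a →
      ∀ s : B, s ≠ a → ∃ αs : BSM cs, αs.dom = dihedral cs s a ∧
        ∀ x ∈ dihedral cs s a, αs.toFun x = φ.toFun x) ∧
    (∀ α : B → BSM cs,
      (∀ s : B, s ≠ a → (α s).dom = dihedral cs s a ∧ (α s).toFun 1 = cs.simple a) →
      ∃ φ : BSM cs, BMax φ ∧
        (∀ s : B, s ≠ a → dihedral cs s a ⊆ φ.dom ∧
          ∀ x ∈ dihedral cs s a, φ.toFun x = (α s).toFun x) ∧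
        ∀ φ' : BSM cs, BMax φ' →
          (∀ s : B, s ≠ a → dihedral cs s a ⊆ φ'.dom ∧
            ∀ x ∈ dihedral cs s a, φ'.toFun x = (α s).toFun x) →
          φ'.dom = φ.dom ∧ ∀ x ∈ φ.dom, φ'.toFun x = φ.toFun x) := by
  have hone : ∀ s : B, (1 : W) ∈ dihedral cs s a := fun s =>
    mem_dihedral.2 (Subgroup.one_mem _)
  refine ⟨fun φ hmax h0 h1 s _ => ?_, fun α hα => ?_⟩
  · refine ⟨φ.restrict (dihedral cs s a) (fun x y hy h => ?_) (fun x hx hxs => ?_), ?_,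
      fun x _ => rfl⟩
    · exact mem_dihedral.2 (parabolic_ideal (mem_dihedral.1 hy) h)
    · exact mem_dihedral.2 (φ.toFun_mem_parabolic h1 (by simp) hx (mem_dihedral.1 hxs))
    · refine Set.inter_eq_right.2 fun x hx => ?_
      exact BSM.parabolic_subset_dom hmax h0 h1 s (mem_dihedral.1 hx)
  · let F : Set (BSM cs) := {ψ | ∀ s, s ≠ a → ∀ x ∈ dihedral cs s a, x ∈ ψ.dom →
      ψ.toFun x = (α s).toFun x}
    have hF1 : ∀ ψ ∈ F, 1 ∈ ψ.dom → ψ.toFun 1 = cs.simple a := by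
      intro ψ hψ h0
      by_cases h : ∀ s, s = a
      · exact ψ.toFun_one_of_subsingleton h h0
      · push Not at h
        obtain ⟨s, hs⟩ := h
        rw [hψ s hs 1 (hone s) h0, (hα s hs).2]
    have hαF : ∀ t, t ≠ a → α t ∈ F := by
      intro t ht s hs x hx hxt
      rw [(hα t ht).1] at hxt
      by_cases hst : s = t
      · rw [hst]
      have hval : ∀ r, r ≠ a → (α r).toFun (cs.simple a) = 1 := by
        intro r hr
        rw [← (hα r hr).2]
        exact (α r).invol 1 (by rw [(hα r hr).1]; exact hone r)
      rcases eq_one_or_eq_simple_of_mem hst (mem_dihedral.1 hx) (mem_dihedral.1 hxt) with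
        rfl | rfl
      · rw [(hα t ht).2, (hα s hs).2]
      · rw [hval t ht, hval s hs]
    obtain ⟨φ, hdom, hφ⟩ := BSM.exists_union F (by
      intro ψ hψ ψ' hψ' x hx hx'
      refine BSM.toFun_eq_of_agree (hF1 ψ hψ (ψ.ideal hx (one_bruhatLE x)))
        (hF1 ψ' hψ' (ψ'.ideal hx' (one_bruhatLE x))) (fun s hs u hu hud hud' => ?_) hx hx'
      rw [hψ s hs u (mem_dihedral.2 hu) hud, hψ' s hs u (mem_dihedral.2 hu) hud'])
    have hsub : ∀ s, s ≠ a → dihedral cs s a ⊆ φ.dom := fun s hs x hx =>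
      (hdom x).2 ⟨α s, hαF s hs, by rwa [(hα s hs).1]⟩
    have hres : ∀ s, s ≠ a → ∀ x ∈ dihedral cs s a, φ.toFun x = (α s).toFun x :=
      fun s hs x hx => hφ _ (hαF s hs) x (by rwa [(hα s hs).1])
    refine ⟨φ, fun ψ hψ => (Set.Subset.antisymm hψ.1 fun x hx => ?_).symm,
      fun s hs => ⟨hsub s hs, hres s hs⟩, fun φ' hmax' hφ' => ?_⟩
    · refine (hdom x).2 ⟨ψ, fun s hs y hy _ => ?_, hx⟩
      rw [hψ.2 y (hsub s hs hy), hres s hs y hy]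
    · have hmem : φ' ∈ F := fun s hs x hx _ => (hφ' s hs).2 x hx
      have hext : BExtends φ φ' := ⟨fun x hx => (hdom x).2 ⟨φ', hmem, hx⟩, hφ φ' hmem⟩
      have heq := (hmax' φ hext).symm
      exact ⟨heq, fun x hx => (hext.2 x (heq ▸ hx)).symm⟩
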